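/- Let C = (c_0, …, c_n) be a 1D crease pattern that is an end sequence, i.e., its interval lengths c_1 − c_0, c_2 − c_1, …, c_n − c_{n−1}, read left to right, first weakly increase and then weakly decrease (equivalently, C contains no crimpable sequence). Then for every MV assignment μ on C, the MV pattern (C, μ) is flat-foldable. -/

import Mathlib

/-- Mountain or valley label for a crease. -/
inductive MV : Type
  | M : MV
  | V : MV
deriving DecidableEq

/-- `(c 0, c 1, …, c n)` is a 1D crease pattern: a strictly increasing finite
sequence of reals with `n ≥ 1`.  The points `c 1, …, c (n-1)` are its creases,
`c 0` and `c n` its ends. -/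
def IsCreasePattern (n : ℕ) (c : ℕ → ℝ) : Prop :=
  1 ≤ n ∧ ∀ i j : ℕ, i < j → j ≤ n → c i < c j

/-- The consecutive creases `(c i, …, c (i+k))` form a crimpable sequence with gap `d`. -/
def IsCrimpable (n : ℕ) (c : ℕ → ℝ) (i k : ℕ) (d : ℝ) : Prop :=
  1 ≤ i ∧ 1 ≤ k ∧ i + k ≤ n - 1 ∧
  (∀ m : ℕ, i ≤ m → m < i + k → c (m + 1) - c m = d) ∧
  d < c i - c (i - 1) ∧ d < c (i + k + 1) - c (i + k)

/-- Additive offset of the folded-position map on the `j`-th interval: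
on `[c j, c (j+1)]` the folded-position map is `x ↦ (-1)^j * x + foldOffset c j`. -/
def foldOffset (c : ℕ → ℝ) : ℕ → ℝ
  | 0 => 0
  | j + 1 => foldOffset c (j) + 2 * (-1 : ℝ) ^ j * c (j + 1)

/-- Folded position of a point `x` belonging to the `j`-th interval `[c j, c (j+1)]`.
This is the unique continuous map equal to the identity on `[c 0, c 1]`, isometric on
every interval, and reversing direction at every crease. -/
def foldPos (c : ℕ → ℝ) (j : ℕ) (x : ℝ) : ℝ := (-1 : ℝ) ^ j * x + foldOffset c j

/-- Folded position of the crease `c i`. -/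
def foldCrease (c : ℕ → ℝ) (i : ℕ) : ℝ := foldPos c i (c i)

/-- `x` lies strictly `lt`-between `a` and `b`. -/
def Between (lt : ℕ → ℕ → Prop) (a b x : ℕ) : Prop :=
  (lt a x ∧ lt x b) ∨ (lt b x ∧ lt x a)

/-- The MV pattern `(C, μ)` is flat-foldable: there is a strict linear order `lt`
("strictly below") on the intervals `I_0, …, I_{n-1}` (indexed `0, …, n-1`) such that:
(i) for each crease `i`, `I_{i-1}` is below `I_i` iff either `μ i = V` and the folded map
is increasing on `I_{i-1}` (slope `(-1)^(i-1) = 1`), or `μ i = M` and it is decreasing;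
(ii) for each crease `i` and each interval `J` whose folded image contains the folded
crease position in its interior, `J` is not strictly between `I_{i-1}` and `I_i`;
(iii) for distinct creases `i, j` folding to the same point, it is not the case that
exactly one of `I_{j-1}`, `I_j` is strictly between `I_{i-1}` and `I_i`. -/
def IsFlatFoldable (n : ℕ) (c : ℕ → ℝ) (μ : ℕ → MV) : Prop :=
  ∃ lt : ℕ → ℕ → Prop,
    (∀ j, j < n → ¬ lt j j) ∧
    (∀ a b e, lt a b → lt b e → lt a e) ∧
    (∀ a b, a < n → b < n → a ≠ b → lt a b ∨ lt b a) ∧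
    (∀ a b, lt a b → a < n ∧ b < n) ∧
    (∀ i, 1 ≤ i → i ≤ n - 1 →
      (lt (i - 1) i ↔ ((μ i = MV.V ∧ Even (i - 1)) ∨ (μ i = MV.M ∧ Odd (i - 1))))) ∧
    (∀ i, 1 ≤ i → i ≤ n - 1 → ∀ j, j < n →
      foldCrease c i ∈
        Set.Ioo (min (foldPos c j (c j)) (foldPos c j (c (j + 1))))
                (max (foldPos c j (c j)) (foldPos c j (c (j + 1)))) →
      ¬ Between lt (i - 1) i j) ∧
    (∀ i j, 1 ≤ i → i ≤ n - 1 → 1 ≤ j → j ≤ n - 1 → i ≠ j →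
      foldCrease c i = foldCrease c j →
      (Between lt (i - 1) i (j - 1) ↔ Between lt (i - 1) i j))

/-- `F` is a forcing set for the MV pattern `(C, μ)`: a set of creases such that the only
flat-foldable assignment agreeing with `μ` on `F` is `μ` itself (on all creases). -/
def IsForcingSet (n : ℕ) (c : ℕ → ℝ) (μ : ℕ → MV) (F : Set ℕ) : Prop :=
  F ⊆ Set.Icc 1 (n - 1) ∧
  ∀ ν : ℕ → MV, IsFlatFoldable n c ν → (∀ x ∈ F, ν x = μ x) →
    ∀ x, 1 ≤ x → x ≤ n - 1 → ν x = μ x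

/-- The crease pattern produced by a monocrimp at the adjacent pair `(c j, c (j+1))`:
it deletes `c j` and `c (j+1)` and translates all later points by `-2 * (c (j+1) - c j)`. -/
def monocrimpPattern (c : ℕ → ℝ) (j : ℕ) : ℕ → ℝ :=
  fun x => if x < j then c x else c (x + 2) - 2 * (c (j + 1) - c j)

open Filter Topology in
/-- A new point `x` can be placed immediately above or below a point `y` of a finite set. -/
lemma exists_insert_adjacent (S : Finset ℕ) (g : ℕ → ℝ) (hg : Set.InjOn g S) {x y : ℕ}
    (hy : y ∈ S) (hx : x ∉ S) (up : Prop) :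
    ∃ g' : ℕ → ℝ, (∀ z ∈ S, g' z = g z) ∧
      (∀ z ∈ S, z ≠ y → (g' x < g z ↔ g y < g z) ∧ (g z < g' x ↔ g z < g y)) ∧
      g' x ≠ g y ∧ (g y < g' x ↔ up) := by
  obtain ⟨ε, hε, hpos⟩ : ∃ ε : ℝ, (∀ z ∈ S, z ≠ y → ε < |g z - g y|) ∧ 0 < ε := by
    have h : ∀ᶠ ε : ℝ in 𝓝[>] 0, ∀ z ∈ S, z ≠ y → ε < |g z - g y| := by
      refine (Filter.eventually_all_finset S).2 fun z hz => ?_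
      by_cases hzy : z = y
      · simp [hzy]
      · have : 0 < |g z - g y| :=
          abs_pos.2 (sub_ne_zero.2 fun h => hzy (hg hz hy h))
        filter_upwards [nhdsWithin_le_nhds (Iio_mem_nhds this)] with ε h _ using h
    exact (h.and self_mem_nhdsWithin).exists
  have hS : ∀ (v : ℝ), ∀ z ∈ S, Function.update g x v z = g z := fun v z hz =>
    Function.update_of_ne (ne_of_mem_of_not_mem hz hx) _ _
  by_cases hup : up
  · refine ⟨Function.update g x (g y + ε), hS _, fun z hz hzy => ?_, ?_, ?_⟩
    · have := hε z hz hzy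
      rw [Function.update_self]
      rcases lt_abs.1 this with h | h <;> constructor <;> constructor <;> intro <;> linarith
    · simp [hpos.ne']
    · simp [hpos, hup]
  · refine ⟨Function.update g x (g y - ε), hS _, fun z hz hzy => ?_, ?_, ?_⟩
    · have := hε z hz hzy
      rw [Function.update_self]
      rcases lt_abs.1 this with h | h <;> constructor <;> constructor <;> intro <;> linarith
    · simp [hpos.ne']
    · simp [hpos.le, hup]

/-- The height function `g` layers the intervals in `S` validly.  Interval `j` is folded onto
the segment with endpoints `P j` and `P (j + 1)`, and `Q i` says that interval `i` lies below
interval `i + 1`. -/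
structure IsLayering (P : ℕ → ℝ) (Q : ℕ → Prop) (S : Finset ℕ) (g : ℕ → ℝ) : Prop where
  injOn : Set.InjOn g S
  lt_iff : ∀ i, i ∈ S → i + 1 ∈ S → (g i < g (i + 1) ↔ Q i)
  not_between : ∀ i, i ∈ S → i + 1 ∈ S → ∀ j ∈ S,
    P (i + 1) ∈ Set.uIoo (P j) (P (j + 1)) → ¬ Between (fun a b => g a < g b) i (i + 1) j
  between_iff : ∀ i j, i ∈ S → i + 1 ∈ S → j ∈ S → j + 1 ∈ S → i ≠ j → P (i + 1) = P (j + 1) →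
    (Between (fun a b => g a < g b) i (i + 1) j ↔
      Between (fun a b => g a < g b) i (i + 1) (j + 1))

/-- A layering extends to a new interval `x` folded into the image of an adjacent interval `y`,
provided `x` has no other neighbour. -/
lemma IsLayering.exists_insert {P : ℕ → ℝ} {Q : ℕ → Prop} {S : Finset ℕ} {g : ℕ → ℝ}
    (h : IsLayering P Q S g) {x y k : ℕ} (hy : y ∈ S) (hx : x ∉ S)
    (hk : (x = k ∧ y = k + 1) ∨ (x = k + 1 ∧ y = k))
    (honly : ∀ i, i ∈ insert x S → i + 1 ∈ insert x S → (i = x ∨ i + 1 = x) → i = k)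
    (hsub : Set.uIoo (P x) (P (x + 1)) ⊆ Set.uIoo (P y) (P (y + 1)))
    (hne : ∀ i ∈ insert x S, P i ≠ P (i + 1)) :
    ∃ g', IsLayering P Q (insert x S) g' := by
  obtain ⟨g', hS, hadj, hxy, hup⟩ := exists_insert_adjacent S g h.injOn hy hx
    ((x = k + 1 ∧ Q k) ∨ (x = k ∧ ¬ Q k))
  have hend : ∀ a b : ℝ, a ∉ Set.uIoo a b ∧ b ∉ Set.uIoo a b := fun a b => by
    simp only [Set.uIoo, Set.mem_Ioo, not_and, not_lt]
    constructor <;> intro h' <;> grind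
  have hxy' : g' x ≠ g' y := by rwa [hS y hy]
  have hx_ne : ∀ z ∈ S, z ≠ x := fun z hz => ne_of_mem_of_not_mem hz hx
  have hpair : ∀ i, i ∈ insert x S → i + 1 ∈ insert x S → i ≠ k → i ∈ S ∧ i + 1 ∈ S := by
    intro i hi hi1 hik
    have := honly i hi hi1
    exact ⟨(Finset.mem_insert.1 hi).resolve_left (by tauto),
      (Finset.mem_insert.1 hi1).resolve_left (by tauto)⟩
  have hold : ∀ a ∈ S, ∀ b ∈ S, ∀ z ∈ S,
      (Between (fun a b => g' a < g' b) a b z ↔ Between (fun a b => g a < g b) a b z) := by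
    intro a ha b hb z hz
    simp only [Between, hS a ha, hS b hb, hS z hz]
  have hnew : ∀ a ∈ S, ∀ b ∈ S, a ≠ y → b ≠ y →
      (Between (fun a b => g' a < g' b) a b x ↔ Between (fun a b => g a < g b) a b y) := by
    intro a ha b hb hay hby
    simp only [Between, hS a ha, hS b hb, hadj a ha hay, hadj b hb hby]
  have hnone : ∀ z ∈ insert x S, ¬ Between (fun a b => g' a < g' b) k (k + 1) z := by
    have : ∀ z ∈ insert x S, ¬ Between (fun a b => g' a < g' b) x y z := by
      intro z hz
      by_cases hzx : z = x
      · simp [hzx, Between]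
      by_cases hzy : z = y
      · simp [hzy, Between]
      have hzS := (Finset.mem_insert.1 hz).resolve_left hzx
      simp only [Between, hS z hzS, hS y hy, hadj z hzS hzy]
      rintro (⟨h₁, h₂⟩ | ⟨h₁, h₂⟩) <;> exact lt_asymm h₁ h₂
    intro z hz
    rcases hk with ⟨rfl, rfl⟩ | ⟨rfl, rfl⟩
    · exact this z hz
    · exact fun hb => this z hz hb.symm
  refine ⟨g', ?_, ?_, ?_, ?_⟩
  · have key : ∀ z ∈ S, g' x ≠ g' z := by
      intro z hz hxz
      by_cases hzy : z = y
      · exact hxy' (hzy ▸ hxz)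
      have := hadj z hz hzy
      rw [hS z hz] at hxz
      refine hzy (h.injOn hz hy (le_antisymm ?_ ?_))
      · exact not_lt.1 fun hlt => (this.1.2 hlt).ne hxz
      · exact not_lt.1 fun hlt => (this.2.2 hlt).ne hxz.symm
    intro a ha b hb hab
    rcases Finset.mem_insert.1 ha with rfl | ha' <;>
      rcases Finset.mem_insert.1 hb with rfl | hb'
    · rfl
    · exact absurd hab (key b hb')
    · exact absurd hab.symm (key a ha')
    · exact h.injOn ha' hb' (by rwa [← hS a ha', ← hS b hb'])
  · intro i hi hi1
    by_cases hik : i = k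
    · subst hik
      rcases hk with ⟨rfl, rfl⟩ | ⟨rfl, rfl⟩
      · rw [hS _ hy, ← not_iff_not, not_lt, le_iff_lt_or_eq, or_iff_left hxy.symm, hup]
        simp
      · rw [hS _ hy, hup]
        simp
    · obtain ⟨hiS, hi1S⟩ := hpair i hi hi1 hik
      rw [hS i hiS, hS _ hi1S]
      exact h.lt_iff i hiS hi1S
  · intro i hi hi1 j hj hP
    by_cases hik : i = k
    · exact hik ▸ hnone j hj
    obtain ⟨hiS, hi1S⟩ := hpair i hi hi1 hik
    rcases Finset.mem_insert.1 hj with rfl | hjS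
    · have hPy := hsub hP
      have hiy : i ≠ y := by rintro rfl; exact (hend _ _).2 hPy
      have hi1y : i + 1 ≠ y := by rintro rfl; exact (hend _ _).1 hPy
      rw [hnew i hiS _ hi1S hiy hi1y]
      exact h.not_between i hiS hi1S y hy hPy
    · rw [hold i hiS _ hi1S j hjS]
      exact h.not_between i hiS hi1S j hjS hP
  · intro i j hi hi1 hj hj1 hij hP
    by_cases hik : i = k
    · exact hik ▸ iff_of_false (hnone j hj) (hnone _ hj1)
    obtain ⟨hiS, hi1S⟩ := hpair i hi hi1 hik
    by_cases hjk : j = k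
    · subst hjk
      have hi1j : i + 1 ≠ j := by rintro rfl; exact hne _ hi1 hP
      have hij1 : i ≠ j + 1 := by rintro rfl; exact hne _ hi hP.symm
      rcases hk with ⟨rfl, rfl⟩ | ⟨rfl, rfl⟩
      · rw [hnew i hiS _ hi1S hij1 (by omega), hold i hiS _ hi1S _ hy]
      · rw [hnew i hiS _ hi1S hij hi1j, hold i hiS _ hi1S _ hy]
    · obtain ⟨hjS, hj1S⟩ := hpair j hj hj1 hjk
      rw [hold i hiS _ hi1S j hjS, hold i hiS _ hi1S _ hj1S]
      exact h.between_iff i j hiS hi1S hjS hj1S hij hP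

lemma foldPos_succ_eq_foldCrease (c : ℕ → ℝ) (j : ℕ) :
    foldPos c j (c (j + 1)) = foldCrease c (j + 1) := by
  simp only [foldCrease, foldPos, foldOffset, pow_succ]
  ring

lemma foldCrease_succ (c : ℕ → ℝ) (j : ℕ) :
    foldCrease c (j + 1) = foldCrease c j + (-1) ^ j * (c (j + 1) - c j) := by
  simp only [foldCrease, foldPos, foldOffset, pow_succ]
  ring

/-- A shorter interval is folded into the image of a longer one on its right. -/
lemma uIoo_foldCrease_subset_succ {c : ℕ → ℝ} {j : ℕ} (h0 : c j ≤ c (j + 1))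
    (h : c (j + 1) - c j ≤ c (j + 2) - c (j + 1)) :
    Set.uIoo (foldCrease c j) (foldCrease c (j + 1)) ⊆
      Set.uIoo (foldCrease c (j + 1)) (foldCrease c (j + 1 + 1)) := by
  rw [foldCrease_succ c (j + 1), foldCrease_succ c j, pow_succ]
  intro z
  simp only [Set.uIoo, Set.mem_Ioo]
  rcases neg_one_pow_eq_or ℝ j with hj | hj <;> rw [hj] <;> grind

/-- A shorter interval is folded into the image of a longer one on its left. -/
lemma uIoo_foldCrease_succ_subset {c : ℕ → ℝ} {j : ℕ} (h0 : c (j + 1) ≤ c (j + 2))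
    (h : c (j + 2) - c (j + 1) ≤ c (j + 1) - c j) :
    Set.uIoo (foldCrease c (j + 1)) (foldCrease c (j + 1 + 1)) ⊆
      Set.uIoo (foldCrease c j) (foldCrease c (j + 1)) := by
  rw [foldCrease_succ c (j + 1), foldCrease_succ c j, pow_succ]
  intro z
  simp only [Set.uIoo, Set.mem_Ioo]
  rcases neg_one_pow_eq_or ℝ j with hj | hj <;> rw [hj] <;> grind

/-- An end sequence admits a layering realizing any prescribed adjacent order `Q`: start from the
longest interval, insert those to its left outwards, then those to its right. -/
lemma exists_isLayering {n p : ℕ} {c : ℕ → ℝ} (hC : IsCreasePattern n c) (hp : p < n)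
    (hinc : ∀ j, j < p → c (j + 1) - c j ≤ c (j + 2) - c (j + 1))
    (hdec : ∀ j, p ≤ j → j + 1 < n → c (j + 2) - c (j + 1) ≤ c (j + 1) - c j)
    (Q : ℕ → Prop) :
    ∃ g, IsLayering (foldCrease c) Q (Finset.range n) g := by
  have hlt : ∀ j, j < n → c j < c (j + 1) := fun j hj => hC.2 j (j + 1) (by omega) (by omega)
  have hne : ∀ j, j < n → foldCrease c j ≠ foldCrease c (j + 1) := by
    intro j hj
    rw [foldCrease_succ, ne_comm, Ne, add_eq_left]
    exact mul_ne_zero (by simp) (sub_ne_zero.2 (hlt j hj).ne')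
  have left : ∀ m, m ≤ p → ∃ g, IsLayering (foldCrease c) Q (Finset.Icc (p - m) p) g := by
    intro m
    induction m with
    | zero =>
      intro _
      exact ⟨0, by simp, by simp, by simp, by simp [Between]⟩
    | succ m ih =>
      intro hm
      obtain ⟨g, hg⟩ := ih (by omega)
      obtain ⟨q, hq⟩ : ∃ q, p - m = q + 1 := ⟨p - m - 1, by omega⟩
      have hS : Finset.Icc (p - (m + 1)) p = insert q (Finset.Icc (p - m) p) := by
        ext a; simp only [Finset.mem_Icc, Finset.mem_insert]; omega
      rw [hS]
      refine hg.exists_insert (x := q) (y := q + 1) (k := q) ?_ ?_ (Or.inl ⟨rfl, rfl⟩) ?_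
        (uIoo_foldCrease_subset_succ (hlt q (by omega)).le (hinc q (by omega))) ?_
      · simp only [Finset.mem_Icc]; omega
      · simp only [Finset.mem_Icc]; omega
      · intro i; simp only [Finset.mem_Icc, Finset.mem_insert]; omega
      · intro i hi
        simp only [Finset.mem_Icc, Finset.mem_insert] at hi
        exact hne i (by omega)
  have right : ∀ m, p + m < n → ∃ g, IsLayering (foldCrease c) Q (Finset.range (p + m + 1)) g := by
    intro m
    induction m with
    | zero =>
      intro _
      have hS : Finset.range (p + 0 + 1) = Finset.Icc (p - p) p := by
        ext a; simp only [Finset.mem_Icc, Finset.mem_range]; omega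
      rw [hS]
      exact left p le_rfl
    | succ m ih =>
      intro hm
      obtain ⟨g, hg⟩ := ih (by omega)
      rw [← Nat.add_assoc, Finset.range_add_one (n := p + m + 1)]
      refine hg.exists_insert (x := p + m + 1) (y := p + m) (k := p + m) ?_ ?_ (Or.inr ⟨rfl, rfl⟩) ?_
        (uIoo_foldCrease_succ_subset (hlt (p + m + 1) (by omega)).le
          (hdec (p + m) (by omega) (by omega))) ?_
      · simp
      · simp
      · intro i; simp only [Finset.mem_range, Finset.mem_insert]; omega
      · intro i hi
        simp only [Finset.mem_range, Finset.mem_insert] at hi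
        exact hne i (by omega)
  have := right (n - 1 - p) (by omega)
  rwa [show p + (n - 1 - p) + 1 = n by omega] at this

/-- If the crease pattern `C = (c 0, …, c n)` is an end sequence — its interval lengths,
read left to right, first weakly increase and then weakly decrease (equivalently, `C`
contains no crimpable sequence) — then every MV assignment on `C` is flat-foldable. -/
theorem end_sequence_any_assignment_foldable (n : ℕ) (c : ℕ → ℝ)
    (hC : IsCreasePattern n c)
    (hEnd : ∃ p, p < n ∧
      (∀ j, j < p → c (j + 1) - c j ≤ c (j + 2) - c (j + 1)) ∧
      (∀ j, p ≤ j → j + 1 < n → c (j + 2) - c (j + 1) ≤ c (j + 1) - c j)) :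
    ∀ μ : ℕ → MV, IsFlatFoldable n c μ := by
  intro μ
  obtain ⟨p, hp, hinc, hdec⟩ := hEnd
  obtain ⟨g, hg⟩ := exists_isLayering hC hp hinc hdec
    (fun i => (μ (i + 1) = MV.V ∧ Even i) ∨ (μ (i + 1) = MV.M ∧ Odd i))
  have hbet : ∀ a b x, a < n → b < n → x < n →
      (Between (fun a b => a < n ∧ b < n ∧ g a < g b) a b x ↔
        Between (fun a b => g a < g b) a b x) := by
    intro a b x ha hb hx
    simp [Between, ha, hb, hx]
  refine ⟨fun a b => a < n ∧ b < n ∧ g a < g b, ?_, ?_, ?_, ?_, ?_, ?_, ?_⟩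
  · exact fun j _ h => lt_irrefl _ h.2.2
  · exact fun a b e h₁ h₂ => ⟨h₁.1, h₂.2.1, h₁.2.2.trans h₂.2.2⟩
  · intro a b ha hb hab
    have : g a ≠ g b := fun h => hab (hg.injOn (by simpa using ha) (by simpa using hb) h)
    simpa [ha, hb] using this
  · exact fun a b h => ⟨h.1, h.2.1⟩
  · intro i hi hin
    obtain ⟨i, rfl⟩ := Nat.exists_eq_add_of_le' hi
    have h₀ : i < n := by omega
    have h₁ : i + 1 < n := by omega
    simpa [h₀, h₁] using hg.lt_iff i (by simpa using h₀) (by simpa using h₁)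
  · intro i hi hin j hj hmem
    obtain ⟨i, rfl⟩ := Nat.exists_eq_add_of_le' hi
    have h₀ : i < n := by omega
    have h₁ : i + 1 < n := by omega
    rw [foldPos_succ_eq_foldCrease] at hmem
    rw [Nat.add_sub_cancel, hbet _ _ _ h₀ h₁ hj]
    exact hg.not_between i (by simpa using h₀) (by simpa using h₁) j (by simpa using hj) hmem
  · intro i j hi hin hj hjn hij hP
    obtain ⟨i, rfl⟩ := Nat.exists_eq_add_of_le' hi
    obtain ⟨j, rfl⟩ := Nat.exists_eq_add_of_le' hj
    have h₀ : i < n := by omega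
    have h₁ : i + 1 < n := by omega
    have h₂ : j < n := by omega
    have h₃ : j + 1 < n := by omega
    rw [Nat.add_sub_cancel, Nat.add_sub_cancel, hbet _ _ _ h₀ h₁ h₂, hbet _ _ _ h₀ h₁ h₃]
    exact hg.between_iff i j (by simpa using h₀) (by simpa using h₁) (by simpa using h₂)
      (by simpa using h₃) (by omega) hP
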